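/- Let α ∈ (0,1) and let g : (0,∞) → ℝ be such that g and y ↦ y·g(y) belong to L¹(0,∞) and g has compact support. Then for all t > 1 and all x > 0, |v^+(x,t) − m·𝔈_t(x)| ≤ (C_2(α)/t^{1/(1+α)})·‖y g(y)‖_{L¹(0,∞)} · ( t^{−1/(1+α)} if x ≤ t^{1/(1+α)}, and 1/x if x > t^{1/(1+α)} ), where C_2(α) = 2 a_0 C_1(α). -/

import Mathlib

open Real MeasureTheory Set Filter Topology

noncomputable def bCoef (α : ℝ) (n : ℕ) : ℝ :=
  ∏ i ∈ Finset.range n, Real.Gamma (α * i + i + 2) / Real.Gamma (α * (i + 1) + i + 2)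

/-- The profile function `Φ(x) = ∑ bₙ (−x^{1+α}/(1+α))ⁿ`. -/
noncomputable def Phi (α : ℝ) (x : ℝ) : ℝ :=
  ∑' n : ℕ, bCoef α n * (-(x ^ (1 + α)) / (1 + α)) ^ n

/-- The Caputo fractional derivative of order `α`. -/
noncomputable def caputo (α : ℝ) (f : ℝ → ℝ) (x : ℝ) : ℝ :=
  (1 / Real.Gamma (1 - α)) * ∫ τ in (0:ℝ)..x, deriv f τ * (x - τ) ^ (-α)

/-- The normalizing constant `a₀` with `1/a₀ = 2∫₀^∞ Φ`. -/
noncomputable def a0 (α : ℝ) : ℝ := (2 * ∫ x in Set.Ioi (0:ℝ), Phi α x)⁻¹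

/-- The fundamental solution `𝔈_t(x) = a₀ t^{−1/(1+α)} Φ(|x| t^{−1/(1+α)})`. -/
noncomputable def fundSol (α t x : ℝ) : ℝ :=
  a0 α * t ^ (-1/(1+α)) * Phi α (|x| * t ^ (-1/(1+α)))

noncomputable def C1 (α : ℝ) : ℝ :=
  α * (2:ℝ) ^ (1+α) * max (∫ u in (1/2:ℝ)..1, u ^ (-(1+α)) * (1-u) ^ (α-1)) 2

noncomputable def C2 (α : ℝ) : ℝ := 2 * a0 α * C1 α

lemma caputo_max {α : ℝ} (hα : α ∈ Set.Ioo (0:ℝ) 1) {f f' : ℝ → ℝ} {x0 : ℝ} (hx0 : 0 < x0)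
    (hf : ContinuousOn f (Icc 0 x0)) (hd : ∀ x, 0 < x → HasDerivAt f (f' x) x)
    (hf' : ContinuousOn f' (Icc 0 x0)) (hmax : ∀ τ ∈ Icc 0 x0, f τ ≤ f x0) :
    0 ≤ ∫ τ in (0:ℝ)..x0, f' τ * (x0 - τ) ^ (-α) := by
  obtain ⟨h0, h1⟩ := hα
  have hker : IntervalIntegrable (fun τ : ℝ => (x0 - τ) ^ (-α)) volume 0 x0 := by
    have := (intervalIntegral.intervalIntegrable_rpow' (a := x0) (b := 0) (r := -α)
      (by linarith)).comp_sub_left x0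
    simpa using this
  have hint : IntervalIntegrable (fun τ : ℝ => f' τ * (x0 - τ) ^ (-α)) volume 0 x0 :=
    hker.continuousOn_mul (by rwa [uIcc_of_le hx0.le])
  have hcont : ContinuousOn (fun b => ∫ τ in (0:ℝ)..b, f' τ * (x0 - τ) ^ (-α)) (Icc 0 x0) := by
    have := intervalIntegral.continuousOn_primitive_interval (f := fun τ => f' τ * (x0 - τ) ^ (-α))
      (a := 0) (b := x0) (μ := volume) (by
        rw [uIcc_of_le hx0.le, integrableOn_Icc_iff_integrableOn_Ioc]
        exact (intervalIntegrable_iff_integrableOn_Ioc_of_le hx0.le).1 hint)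
    rwa [uIcc_of_le hx0.le] at this
  have hev : ∀ᶠ b in 𝓝[<] x0, b ∈ Ioo 0 x0 := Ioo_mem_nhdsLT hx0
  have hle : 𝓝[<] x0 ≤ 𝓝[Icc 0 x0] x0 := by
    refine nhdsWithin_le_iff.2 ?_
    filter_upwards [hev] with b hb using ⟨hb.1.le, hb.2.le⟩
  have hT1 : Tendsto (fun b => ∫ τ in (0:ℝ)..b, f' τ * (x0 - τ) ^ (-α)) (𝓝[<] x0)
      (𝓝 (∫ τ in (0:ℝ)..x0, f' τ * (x0 - τ) ^ (-α))) :=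
    (hcont x0 ⟨hx0.le, le_rfl⟩).tendsto.mono_left hle
  have hT2 : Tendsto (fun b => -(slope f x0 b) * (x0 - b) ^ (1 - α)) (𝓝[<] x0) (𝓝 0) := by
    have h1' : Tendsto (slope f x0) (𝓝[<] x0) (𝓝 (f' x0)) :=
      (hasDerivAt_iff_tendsto_slope.1 (hd x0 hx0)).mono_left
        (nhdsWithin_mono _ (fun b hb => ne_of_lt hb))
    have h2' : Tendsto (fun b : ℝ => (x0 - b) ^ (1 - α)) (𝓝[<] x0) (𝓝 0) := by
      have hc : Continuous (fun b : ℝ => (x0 - b) ^ (1 - α)) :=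
        (continuous_const.sub continuous_id).rpow_const (fun _ => Or.inr (by linarith))
      have := hc.tendsto x0
      simp only [sub_self] at this
      rw [Real.zero_rpow (by linarith)] at this
      exact this.mono_left nhdsWithin_le_nhds
    simpa using h1'.neg.mul h2'
  refine le_of_tendsto_of_tendsto hT2 hT1 ?_
  filter_upwards [hev] with b hb
  obtain ⟨hb0, hbx⟩ := hb
  have hne : ∀ τ ∈ Icc 0 b, 0 < x0 - τ := fun τ hτ => by linarith [hτ.2]
  have hsub : Icc 0 b ⊆ Icc 0 x0 := Icc_subset_Icc le_rfl hbx.le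
  have hvc : ∀ r : ℝ, ContinuousOn (fun τ : ℝ => (x0 - τ) ^ r) (Icc 0 b) := fun r =>
    (continuousOn_const.sub continuousOn_id).rpow_const (fun τ hτ => Or.inl (hne τ hτ).ne')
  have hparts := intervalIntegral.integral_deriv_mul_eq_sub_of_hasDerivAt (a := 0) (b := b)
    (u := fun τ => f τ - f x0) (v := fun τ => (x0 - τ) ^ (-α)) (u' := f')
    (v' := fun τ => α * (x0 - τ) ^ (-α - 1))
    (by rw [uIcc_of_le hb0.le]; exact (hf.mono hsub).sub continuousOn_const)
    (by rw [uIcc_of_le hb0.le]; exact hvc _)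
    (by
      intro x hx
      rw [min_eq_left hb0.le, max_eq_right hb0.le] at hx
      exact (hd x hx.1).sub_const _)
    (by
      intro x hx
      rw [min_eq_left hb0.le, max_eq_right hb0.le] at hx
      have := ((hasDerivAt_id x).const_sub x0).rpow_const (p := -α)
        (Or.inl (hne x ⟨hx.1.le, hx.2.le⟩).ne')
      have e : α * (x0 - x) ^ (-α - 1) = -1 * -α * (x0 - id x) ^ (-α - 1) := by
        simp only [id]; ring
      rw [e]
      exact this)
    (by
      apply ContinuousOn.intervalIntegrable
      rw [uIcc_of_le hb0.le]; exact hf'.mono hsub)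
    (by
      apply ContinuousOn.intervalIntegrable
      rw [uIcc_of_le hb0.le]; exact continuousOn_const.mul (hvc _))
  rw [intervalIntegral.integral_add] at hparts
  rotate_left
  · apply ContinuousOn.intervalIntegrable
    rw [uIcc_of_le hb0.le]; exact (hf'.mono hsub).mul (hvc _)
  · apply ContinuousOn.intervalIntegrable
    rw [uIcc_of_le hb0.le]
    exact ((hf.mono hsub).sub continuousOn_const).mul (continuousOn_const.mul (hvc _))
  have hneg : ∫ τ in (0:ℝ)..b, (f τ - f x0) * (α * (x0 - τ) ^ (-α - 1)) ≤ 0 := by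
    have : 0 ≤ ∫ τ in (0:ℝ)..b, -((f τ - f x0) * (α * (x0 - τ) ^ (-α - 1))) := by
      apply intervalIntegral.integral_nonneg hb0.le
      intro τ hτ
      have a1 := hmax τ (hsub hτ)
      have a2 := Real.rpow_nonneg (hne τ hτ).le (-α - 1)
      have a3 := mul_nonneg h0.le a2
      nlinarith
    rw [intervalIntegral.integral_neg] at this
    linarith
  have h00 := hmax 0 ⟨le_rfl, hx0.le⟩
  have hp0 := Real.rpow_nonneg (sub_nonneg.2 hx0.le) (-α)
  have key : -(slope f x0 b) * (x0 - b) ^ (1 - α) = (f b - f x0) * (x0 - b) ^ (-α) := by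
    have hpos : 0 < x0 - b := by linarith
    rw [show (1 - α) = 1 + (-α) by ring, Real.rpow_add hpos, Real.rpow_one, slope_def_field]
    have : b - x0 ≠ 0 := by linarith
    field_simp
    ring
  rw [key]
  nlinarith

lemma caputo_comp {α : ℝ} (hα : α ∈ Set.Ioo (0:ℝ) 1) {f f' : ℝ → ℝ} {M : ℝ}
    (hf : ContinuousOn f (Ici 0)) (hd : ∀ x, 0 < x → HasDerivAt f (f' x) x)
    (hf' : ContinuousOn f' (Ici 0)) (h0 : f 0 ≤ M)
    (hL : ∀ x, 0 < x → M < f x → ∫ τ in (0:ℝ)..x, f' τ * (x - τ) ^ (-α) < 0) :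
    ∀ x, 0 ≤ x → f x ≤ M := by
  intro x hx
  by_contra! hM
  obtain ⟨x0, hx0, hmax⟩ := isCompact_Icc.exists_isMaxOn (nonempty_Icc.2 hx)
    (hf.mono (fun y (hy : y ∈ Icc 0 x) => hy.1))
  have hm := hmax (a := x) ⟨hx, le_rfl⟩
  change f x ≤ f x0 at hm
  have hfx0 : M < f x0 := lt_of_lt_of_le hM hm
  have hpos : 0 < x0 := by
    rcases hx0.1.eq_or_lt with h | h
    · rw [← h] at hfx0; linarith
    · exact h
  have hs : Icc 0 x0 ⊆ Ici (0:ℝ) := fun y hy => hy.1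
  have := caputo_max hα hpos (hf.mono hs) hd (hf'.mono hs)
    (fun τ hτ => hmax (a := τ) ⟨hτ.1, hτ.2.trans hx0.2⟩)
  linarith [hL x0 hpos hfx0]

lemma bCoef_pos {α : ℝ} (hα : α ∈ Set.Ioo (0:ℝ) 1) (n : ℕ) : 0 < bCoef α n := by
  obtain ⟨h0, h1⟩ := hα
  unfold bCoef
  refine Finset.prod_pos fun i _ => ?_
  have : (0:ℝ) ≤ i := i.cast_nonneg
  exact div_pos (Real.Gamma_pos_of_pos (by positivity)) (Real.Gamma_pos_of_pos (by positivity))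

lemma bCoef_succ (α : ℝ) (n : ℕ) : bCoef α (n+1) = bCoef α n *
    (Real.Gamma (α * n + n + 2) / Real.Gamma (α * (n + 1) + n + 2)) := by
  unfold bCoef; rw [Finset.prod_range_succ]

lemma bCoef_le_one {α : ℝ} (hα : α ∈ Set.Ioo (0:ℝ) 1) (n : ℕ) : bCoef α n ≤ 1 := by
  obtain ⟨h0, h1⟩ := hα
  unfold bCoef
  have hn : ∀ i : ℕ, (0:ℝ) ≤ i := fun i => i.cast_nonneg
  refine Finset.prod_le_one (fun i _ => ?_) (fun i _ => ?_)
  · have := hn i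
    exact div_nonneg (Real.Gamma_pos_of_pos (by positivity)).le
      (Real.Gamma_pos_of_pos (by positivity)).le
  · have := hn i
    rw [div_le_one (Real.Gamma_pos_of_pos (by positivity))]
    have hai : 0 ≤ α * i := by positivity
    exact Real.Gamma_strictMonoOn_Ici.monotoneOn (by simp only [mem_Ici]; linarith)
      (by simp only [mem_Ici]; linarith) (by linarith)

lemma Gamma_ratio_le {α s : ℝ} (hα : α ∈ Set.Ioo (0:ℝ) 1) (hs : 1 ≤ s) :
    Real.Gamma s / Real.Gamma (s + α) ≤ 2 * s ^ (-α) := by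
  obtain ⟨h0, h1⟩ := hα
  have hG : 0 < Real.Gamma (s + α) := Real.Gamma_pos_of_pos (by linarith)
  have h := Real.Gamma_mul_add_mul_le_rpow_Gamma_mul_rpow_Gamma (s := s + α) (t := s + α + 1)
    (a := α) (b := 1 - α) (by linarith) (by linarith) h0 (by linarith) (by ring)
  rw [show α * (s + α) + (1 - α) * (s + α + 1) = s + 1 by ring,
    Real.Gamma_add_one (by linarith), Real.Gamma_add_one (by linarith),
    Real.mul_rpow (by linarith) hG.le] at h
  have e : Real.Gamma (s + α) ^ α * ((s + α) ^ (1 - α) * Real.Gamma (s + α) ^ (1 - α))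
      = Real.Gamma (s+α) * (s + α) ^ (1 - α) := by
    have : Real.Gamma (s + α) ^ α * Real.Gamma (s + α) ^ (1 - α) = Real.Gamma (s+α) := by
      rw [← Real.rpow_add hG]; simp
    calc _ = (Real.Gamma (s + α) ^ α * Real.Gamma (s + α) ^ (1 - α)) * (s + α) ^ (1 - α) := by ring
      _ = _ := by rw [this]
  rw [e] at h
  have hb : (s + α) ^ (1 - α) ≤ 2 * s ^ (1 - α) := by
    calc (s + α) ^ (1 - α) ≤ (2 * s) ^ (1 - α) :=
          Real.rpow_le_rpow (by linarith) (by linarith) (by linarith)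
      _ = 2 ^ (1 - α) * s ^ (1 - α) := Real.mul_rpow (by norm_num) (by linarith)
      _ ≤ 2 * s ^ (1 - α) := by
          gcongr
          calc (2:ℝ) ^ (1 - α) ≤ 2 ^ (1:ℝ) :=
                Real.rpow_le_rpow_of_exponent_le (by norm_num) (by linarith)
            _ = 2 := by simp
  rw [div_le_iff₀ hG]
  have hs1 : s ^ (1 - α) = s * s ^ (-α) := by
    rw [sub_eq_add_neg, Real.rpow_add (by linarith), Real.rpow_one]
  rw [hs1] at hb
  have : s * Real.Gamma s ≤ s * (2 * s ^ (-α) * Real.Gamma (s + α)) := by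
    calc _ ≤ _ := h
      _ ≤ Real.Gamma (s + α) * (2 * (s * s ^ (-α))) := by gcongr
      _ = _ := by ring
  exact le_of_mul_le_mul_left this (by linarith)

lemma summable_b {α : ℝ} (hα : α ∈ Set.Ioo (0:ℝ) 1) {R : ℝ} (hR : 0 < R) :
    Summable (fun n : ℕ => bCoef α n * R ^ n) := by
  refine summable_of_ratio_test_tendsto_lt_one (l := 0) one_pos
    (Eventually.of_forall fun n => (mul_pos (bCoef_pos hα n) (pow_pos hR n)).ne') ?_
  have hT : Tendsto (fun n : ℕ => R * (2 * (n:ℝ) ^ (-α))) atTop (𝓝 0) := by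
    have := (tendsto_rpow_neg_atTop hα.1).comp (tendsto_natCast_atTop_atTop (R := ℝ))
    simpa using (this.const_mul 2).const_mul R
  refine squeeze_zero' (Eventually.of_forall fun n => by positivity) ?_ hT
  filter_upwards [eventually_ge_atTop 1] with n hn
  have hn' : (1:ℝ) ≤ n := by exact_mod_cast hn
  have hb := bCoef_pos hα n
  rw [Real.norm_of_nonneg (mul_pos (bCoef_pos hα _) (pow_pos hR _)).le,
    Real.norm_of_nonneg (mul_pos (bCoef_pos hα _) (pow_pos hR _)).le, bCoef_succ]
  have hai : 0 ≤ α * n := mul_nonneg hα.1.le (by linarith)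
  have h := Gamma_ratio_le hα (s := α * n + n + 2) (by linarith)
  rw [show α * (n:ℝ) + n + 2 + α = α * (n + 1) + n + 2 by ring] at h
  have h2 : (α * (n:ℝ) + n + 2) ^ (-α) ≤ (n:ℝ) ^ (-α) :=
    Real.rpow_le_rpow_of_nonpos (by linarith) (by linarith) (by linarith [hα.1])
  calc _ = R * (Real.Gamma (α * n + n + 2) / Real.Gamma (α * (n + 1) + n + 2)) := by
        rw [pow_succ]; field_simp
    _ ≤ _ := by gcongr; linarith

lemma summable_nb {α : ℝ} (hα : α ∈ Set.Ioo (0:ℝ) 1) {R : ℝ} (hR : 0 < R) :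
    Summable (fun n : ℕ => bCoef α n * (n * R ^ n)) := by
  refine Summable.of_nonneg_of_le (fun n => ?_) (fun n => ?_) (summable_b hα (R := 2 * R) (by linarith))
  · have := bCoef_pos hα n; positivity
  · have := bCoef_pos hα n
    rw [mul_pow]
    have h2 : (n:ℝ) ≤ 2 ^ n := by exact_mod_cast Nat.lt_two_pow_self.le
    gcongr

noncomputable def cf (α : ℝ) (n : ℕ) : ℝ := bCoef α n * (-1 / (1 + α)) ^ n

noncomputable def dPhi (α x : ℝ) : ℝ :=
  ∑' n : ℕ, cf α n * ((1 + α) * n * x ^ ((1 + α) * n - 1))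

lemma Phi_eq {α x : ℝ} (hx : 0 ≤ x) : Phi α x = ∑' n : ℕ, cf α n * x ^ ((1 + α) * n) := by
  unfold Phi cf
  refine tsum_congr fun n => ?_
  rw [Real.rpow_mul_natCast hx, mul_assoc, ← mul_pow]
  congr 2
  ring

lemma abs_cf_eq {α : ℝ} (hα : α ∈ Set.Ioo (0:ℝ) 1) (n : ℕ) :
    |cf α n| = bCoef α n * (1 / (1 + α)) ^ n := by
  have h : 0 < 1 + α := by linarith [hα.1]
  rw [cf, abs_mul, abs_pow, abs_div, abs_neg, abs_one, abs_of_pos h, abs_of_pos (bCoef_pos hα n)]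

lemma abs_cf_le {α : ℝ} (hα : α ∈ Set.Ioo (0:ℝ) 1) (n : ℕ) : |cf α n| ≤ bCoef α n := by
  have h : 0 < 1 + α := by linarith [hα.1]
  rw [abs_cf_eq hα]
  refine mul_le_of_le_one_right (bCoef_pos hα n).le (pow_le_one₀ (by positivity) ?_)
  rw [div_le_one h]; linarith [hα.1]

lemma term_bound {α : ℝ} (hα : α ∈ Set.Ioo (0:ℝ) 1) {x R : ℝ} (hx : 0 ≤ x) (hxR : x ≤ R) (n : ℕ) :
    ‖cf α n * x ^ ((1 + α) * n)‖ ≤ bCoef α n * (R ^ (1 + α)) ^ n := by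
  rw [norm_mul, Real.norm_eq_abs, Real.norm_of_nonneg (Real.rpow_nonneg hx _),
    Real.rpow_mul_natCast hx]
  have := hα.1
  have hb := (bCoef_pos hα n).le
  gcongr
  exact abs_cf_le hα n

lemma dterm_bound {α : ℝ} (hα : α ∈ Set.Ioo (0:ℝ) 1) {x R : ℝ} (hx : 0 ≤ x) (hxR : x ≤ R)
    (hR : 1 ≤ R) (n : ℕ) :
    ‖cf α n * ((1 + α) * n * x ^ ((1 + α) * n - 1))‖ ≤
      2 * (bCoef α n * (n * (R ^ (1 + α)) ^ n)) := by
  have h0 := hα.1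
  have h1 := hα.2
  have hb := bCoef_pos hα n
  rcases Nat.eq_zero_or_pos n with rfl | hn
  · simp
  have hn' : (1:ℝ) ≤ n := by exact_mod_cast hn
  have hp : 0 ≤ (1 + α) * n - 1 := by nlinarith
  rw [norm_mul, Real.norm_eq_abs, Real.norm_of_nonneg (by positivity)]
  have e : x ^ ((1 + α) * n - 1) ≤ (R ^ (1 + α)) ^ n := by
    rw [← Real.rpow_mul_natCast (by linarith)]
    calc x ^ ((1 + α) * n - 1) ≤ R ^ ((1 + α) * n - 1) := by gcongr
      _ ≤ _ := Real.rpow_le_rpow_of_exponent_le hR (by linarith)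
  calc _ ≤ bCoef α n * (2 * n * (R ^ (1 + α)) ^ n) := by
        gcongr
        · exact abs_cf_le hα n
        · linarith
    _ = _ := by ring

lemma summable_term {α : ℝ} (hα : α ∈ Set.Ioo (0:ℝ) 1) {x : ℝ} (hx : 0 ≤ x) :
    Summable (fun n : ℕ => cf α n * x ^ ((1 + α) * n)) :=
  Summable.of_norm_bounded
    (summable_b hα (R := (x + 1) ^ (1 + α)) (Real.rpow_pos_of_pos (by linarith) _))
    (fun n => term_bound hα hx (by linarith) n)

lemma summable_dbound {α : ℝ} (hα : α ∈ Set.Ioo (0:ℝ) 1) {R : ℝ} (hR : 1 ≤ R) :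
    Summable (fun n : ℕ => 2 * (bCoef α n * (n * (R ^ (1 + α)) ^ n))) :=
  (summable_nb hα (Real.rpow_pos_of_pos (by linarith) _)).mul_left 2

lemma cont_of_Icc {f : ℝ → ℝ} (h : ∀ R, 1 ≤ R → ContinuousOn f (Icc 0 R)) :
    ContinuousOn f (Ici 0) := by
  intro x hx
  have hx' : 0 ≤ x := hx
  have := h (x + 1) (by linarith) x ⟨hx, by linarith⟩
  refine this.mono_of_mem_nhdsWithin ?_
  rw [← Ici_inter_Iic]
  exact inter_mem self_mem_nhdsWithin (mem_nhdsWithin_of_mem_nhds (Iic_mem_nhds (by linarith)))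

lemma Phi_cont {α : ℝ} (hα : α ∈ Set.Ioo (0:ℝ) 1) : ContinuousOn (Phi α) (Ici 0) := by
  have h0 := hα.1
  apply cont_of_Icc
  intro R hR
  refine ContinuousOn.congr (f := fun x => ∑' n : ℕ, cf α n * x ^ ((1 + α) * n)) ?_
    (fun x hx => Phi_eq hx.1)
  refine continuousOn_tsum (fun n => ?_)
    (summable_b hα (R := R ^ (1 + α)) (Real.rpow_pos_of_pos (by linarith) _))
    (fun n x hx => term_bound hα hx.1 hx.2 n)
  exact (continuous_const.mul (Real.continuous_rpow_const (by positivity))).continuousOn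

lemma dterm_cont {α : ℝ} (hα : α ∈ Set.Ioo (0:ℝ) 1) (n : ℕ) :
    Continuous (fun x : ℝ => cf α n * ((1 + α) * n * x ^ ((1 + α) * n - 1))) := by
  rcases Nat.eq_zero_or_pos n with rfl | hn
  · simpa using continuous_const
  · have hn' : (1:ℝ) ≤ n := by exact_mod_cast hn
    have h0 := hα.1
    exact continuous_const.mul (continuous_const.mul (Real.continuous_rpow_const (by nlinarith)))

lemma dPhi_cont {α : ℝ} (hα : α ∈ Set.Ioo (0:ℝ) 1) : ContinuousOn (dPhi α) (Ici 0) := by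
  apply cont_of_Icc
  intro R hR
  exact continuousOn_tsum (fun n => (dterm_cont hα n).continuousOn)
    (summable_dbound hα hR) (fun n x hx => dterm_bound hα hx.1 hx.2 hR n)

lemma Phi_deriv {α : ℝ} (hα : α ∈ Set.Ioo (0:ℝ) 1) (x : ℝ) (hx : 0 < x) :
    HasDerivAt (Phi α) (dPhi α x) x := by
  have hR : 1 ≤ x + 1 := by linarith
  have hmem : x ∈ Ioo 0 (x + 1) := ⟨hx, by linarith⟩
  have := hasDerivAt_tsum_of_isPreconnected (𝕜 := ℝ) (F := ℝ)
    (g := fun (n : ℕ) x => cf α n * x ^ ((1 + α) * n))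
    (g' := fun n x => cf α n * ((1 + α) * n * x ^ ((1 + α) * n - 1)))
    (t := Ioo 0 (x + 1)) (y₀ := x) (y := x)
    (summable_dbound hα hR) isOpen_Ioo isPreconnected_Ioo
    (fun n y hy => (Real.hasDerivAt_rpow_const (Or.inl hy.1.ne')).const_mul _)
    (fun n y hy => dterm_bound hα hy.1.le hy.2.le hR n) hmem (summable_term hα hx.le) hmem
  refine this.congr_of_eventuallyEq ?_
  filter_upwards [Ioi_mem_nhds hx] with y hy
  exact Phi_eq (le_of_lt hy)

lemma Phi_zero {α : ℝ} (hα : α ∈ Set.Ioo (0:ℝ) 1) : Phi α 0 = 1 := by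
  have h0 := hα.1
  rw [Phi_eq le_rfl, tsum_eq_single 0]
  · simp [cf, bCoef]
  · intro n hn
    have : (1 + α) * (n:ℝ) ≠ 0 := by positivity
    rw [Real.zero_rpow this, mul_zero]

lemma beta_int {p q x : ℝ} (hp : 0 < p) (hq : 0 < q) (hx : 0 < x) :
    ∫ τ in (0:ℝ)..x, τ ^ (p - 1) * (x - τ) ^ (q - 1) =
      x ^ (p + q - 1) * (Real.Gamma p * Real.Gamma q / Real.Gamma (p + q)) := by
  have h := Complex.betaIntegral_scaled (p : ℂ) (q : ℂ) hx
  rw [Complex.betaIntegral_eq_Gamma_mul_div _ _ (by simpa) (by simpa)] at h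
  apply Complex.ofReal_injective
  rw [← intervalIntegral.integral_ofReal]
  have e : ∫ τ in (0:ℝ)..x, ((τ ^ (p - 1) * (x - τ) ^ (q - 1) : ℝ) : ℂ) =
      ∫ τ in (0:ℝ)..x, (τ : ℂ) ^ ((p:ℂ) - 1) * ((x : ℂ) - τ) ^ ((q:ℂ) - 1) := by
    refine intervalIntegral.integral_congr fun τ hτ => ?_
    rw [uIcc_of_le hx.le] at hτ
    simp only [Complex.ofReal_mul]
    rw [Complex.ofReal_cpow hτ.1, Complex.ofReal_cpow (sub_nonneg.2 hτ.2)]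
    simp
  rw [e, h]
  push_cast
  rw [Complex.ofReal_cpow hx.le, ← Complex.ofReal_add, Complex.Gamma_ofReal, Complex.Gamma_ofReal,
    Complex.Gamma_ofReal]
  push_cast
  rfl

lemma ker_int {α x : ℝ} (hα : α ∈ Set.Ioo (0:ℝ) 1) :
    IntervalIntegrable (fun τ : ℝ => (x - τ) ^ (-α)) volume 0 x := by
  have := (intervalIntegral.intervalIntegrable_rpow' (a := x) (b := 0) (r := -α)
    (by linarith [hα.2])).comp_sub_left x
  simpa using this

lemma caputo_Phi {α : ℝ} (hα : α ∈ Set.Ioo (0:ℝ) 1) {x : ℝ} (hx : 0 < x) :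
    ∫ τ in (0:ℝ)..x, dPhi α τ * (x - τ) ^ (-α) =
      -(Real.Gamma (1 - α) / (1 + α)) * x * Phi α x := by
  have h0 := hα.1
  have h1 := hα.2
  have hR : 1 ≤ x + 1 := by linarith
  have hs : ∀ τ ∈ uIoc 0 x, 0 ≤ τ ∧ τ ≤ x + 1 ∧ 0 ≤ x - τ := by
    intro τ hτ
    rw [uIoc_of_le hx.le] at hτ
    exact ⟨hτ.1.le, by linarith [hτ.2], by linarith [hτ.2]⟩
  have hsum := intervalIntegral.hasSum_integral_of_dominated_convergence (μ := volume)
    (a := 0) (b := x)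
    (F := fun (n : ℕ) τ => (cf α n * ((1 + α) * n * τ ^ ((1 + α) * n - 1))) * (x - τ) ^ (-α))
    (f := fun τ => dPhi α τ * (x - τ) ^ (-α))
    (fun n τ => (2 * (bCoef α n * (n * ((x + 1) ^ (1 + α)) ^ n))) * (x - τ) ^ (-α))
    (fun n => by
      refine ((dterm_cont hα n).measurable.mul ?_).aestronglyMeasurable
      fun_prop)
    (fun n => Eventually.of_forall fun τ hτ => by
      obtain ⟨a, b, c⟩ := hs τ hτ
      rw [norm_mul, Real.norm_of_nonneg (Real.rpow_nonneg c _)]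
      exact mul_le_mul_of_nonneg_right (dterm_bound hα a b hR n) (Real.rpow_nonneg c _))
    (Eventually.of_forall fun τ hτ => (summable_dbound hα hR).mul_right _)
    (by
      simp_rw [tsum_mul_right]
      exact (ker_int hα).const_mul _)
    (Eventually.of_forall fun τ hτ => by
      obtain ⟨a, b, c⟩ := hs τ hτ
      refine HasSum.mul_right _ ?_
      exact (Summable.of_norm_bounded (summable_dbound hα hR)
        (fun n => dterm_bound hα a b hR n)).hasSum)
  have hterm : ∀ m : ℕ, ∫ τ in (0:ℝ)..x, (cf α (m+1) * ((1 + α) * (m+1:ℕ) *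
      τ ^ ((1 + α) * (m+1:ℕ) - 1))) * (x - τ) ^ (-α) =
      -(Real.Gamma (1 - α) / (1 + α)) * x * (cf α m * x ^ ((1 + α) * m)) := by
    intro m
    have hm : (0:ℝ) ≤ m := m.cast_nonneg
    have hb := beta_int (p := (1 + α) * (m + 1)) (q := 1 - α) (x := x) (by positivity)
      (by linarith) hx
    rw [show (1 - α - 1) = -α by ring] at hb
    have hpull : ∫ τ in (0:ℝ)..x, (cf α (m+1) * ((1 + α) * (m+1:ℕ) *
      τ ^ ((1 + α) * (m+1:ℕ) - 1))) * (x - τ) ^ (-α) = (cf α (m+1) * ((1 + α) * (m+1))) *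
        ∫ τ in (0:ℝ)..x, τ ^ ((1 + α) * (m + 1) - 1) * (x - τ) ^ (-α) := by
      rw [← intervalIntegral.integral_const_mul]
      congr 1
      funext τ
      push_cast
      ring
    rw [hpull, hb]
    have hxp : x ^ ((1 + α) * (m + 1) + (1 - α) - 1) = x * x ^ ((1 + α) * m) := by
      rw [show (1 + α) * ((m:ℝ) + 1) + (1 - α) - 1 = 1 + (1 + α) * m by ring,
        Real.rpow_add hx, Real.rpow_one]
    have hg1 := Real.Gamma_add_one (s := (1 + α) * (m + 1)) (by positivity)
    rw [show (1 + α) * ((m:ℝ) + 1) + 1 = α * (m + 1) + m + 2 by ring] at hg1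
    have hg2 : (1 + α) * ((m:ℝ) + 1) + (1 - α) = α * m + m + 2 := by ring
    have hG1 : Real.Gamma ((1 + α) * (m + 1)) ≠ 0 := (Real.Gamma_pos_of_pos (by positivity)).ne'
    have hG2 : Real.Gamma (α * m + m + 2) ≠ 0 := (Real.Gamma_pos_of_pos (by positivity)).ne'
    rw [hxp, hg2, cf, cf, bCoef_succ, hg1, pow_succ]
    have h1a : 1 + α ≠ 0 := by positivity
    have hm1 : (m:ℝ) + 1 ≠ 0 := by positivity
    field_simp
  have hP := (summable_term hα hx.le).hasSum.mul_left (-(Real.Gamma (1 - α) / (1 + α)) * x)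
  rw [← Phi_eq hx.le] at hP
  simp_rw [← hterm] at hP
  have hP' := (hasSum_nat_add_iff (f := fun n : ℕ => ∫ τ in (0:ℝ)..x, (cf α n * ((1 + α) * n *
      τ ^ ((1 + α) * n - 1))) * (x - τ) ^ (-α)) 1).1 hP
  rw [hsum.unique hP']
  simp

lemma Kpos {α : ℝ} (hα : α ∈ Set.Ioo (0:ℝ) 1) : 0 < Real.Gamma (1 - α) / (1 + α) :=
  div_pos (Real.Gamma_pos_of_pos (by linarith [hα.2])) (by linarith [hα.1])

lemma Phi_nonneg {α : ℝ} (hα : α ∈ Set.Ioo (0:ℝ) 1) {x : ℝ} (hx : 0 ≤ x) : 0 ≤ Phi α x := by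
  have := caputo_comp hα (f := fun x => -Phi α x) (f' := fun x => -dPhi α x) (M := 0)
    (Phi_cont hα).neg (fun x hx => (Phi_deriv hα x hx).neg) (dPhi_cont hα).neg
    (by rw [Phi_zero hα]; norm_num)
    (by
      intro x hx hM
      simp only [neg_mul, intervalIntegral.integral_neg]
      rw [caputo_Phi hα hx]
      have := mul_pos (mul_pos (Kpos hα) hx) hM
      linarith) x hx
  linarith

lemma Phi_le_one {α : ℝ} (hα : α ∈ Set.Ioo (0:ℝ) 1) {x : ℝ} (hx : 0 ≤ x) : Phi α x ≤ 1 := by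
  refine caputo_comp hα (f := Phi α) (f' := dPhi α) (M := 1)
    (Phi_cont hα) (Phi_deriv hα) (dPhi_cont hα)
    (by rw [Phi_zero hα]) ?_ x hx
  intro x hx hM
  rw [caputo_Phi hα hx]
  have := mul_pos (mul_pos (Kpos hα) hx) (one_pos.trans hM)
  linarith

lemma caputo_scale {α : ℝ} (hα : α ∈ Set.Ioo (0:ℝ) 1) {l x : ℝ} (hl : 0 < l) (hx : 0 < x) :
    ∫ τ in (0:ℝ)..x, (l * dPhi α (l * τ)) * (x - τ) ^ (-α) =
      -(Real.Gamma (1 - α) / (1 + α)) * l ^ (1 + α) * x * Phi α (l * x) := by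
  have e : ∫ τ in (0:ℝ)..x, (l * dPhi α (l * τ)) * (x - τ) ^ (-α) =
      ∫ τ in (0:ℝ)..x, (l ^ α * l) * (dPhi α (l * τ) * (l * x - l * τ) ^ (-α)) := by
    refine intervalIntegral.integral_congr fun τ hτ => ?_
    rw [uIcc_of_le hx.le] at hτ
    rw [← mul_sub, Real.mul_rpow hl.le (sub_nonneg.2 hτ.2), Real.rpow_neg hl.le]
    have := (Real.rpow_pos_of_pos hl α).ne'
    field_simp
  have h2 := intervalIntegral.smul_integral_comp_mul_left (a := 0) (b := x)
    (fun σ => dPhi α σ * (l * x - σ) ^ (-α)) l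
  rw [mul_zero, caputo_Phi hα (mul_pos hl hx), smul_eq_mul] at h2
  rw [e, intervalIntegral.integral_const_mul, mul_assoc, h2, Real.rpow_add hl, Real.rpow_one]
  ring

lemma scale_facts {α : ℝ} (hα : α ∈ Set.Ioo (0:ℝ) 1) {l : ℝ} (hl : 1 ≤ l) {x : ℝ} (hx : 0 ≤ x) :
    0 ≤ Phi α x - Phi α (l * x) ∧ Phi α x - Phi α (l * x) ≤ 1 - (l ^ (1 + α))⁻¹ := by
  have h0 := hα.1
  have hl0 : 0 < l := by linarith
  have hL1 : 1 ≤ l ^ (1 + α) := Real.one_le_rpow hl (by linarith)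
  have hmaps : MapsTo (fun x => l * x) (Ici (0:ℝ)) (Ici 0) := fun y hy => mul_nonneg hl0.le hy
  have hlin : ContinuousOn (fun x : ℝ => l * x) (Ici 0) := by fun_prop
  have c1 : ContinuousOn (fun x => Phi α x - Phi α (l * x)) (Ici 0) :=
    (Phi_cont hα).sub ((Phi_cont hα).comp hlin hmaps)
  have c2 : ContinuousOn (fun x => dPhi α x - l * dPhi α (l * x)) (Ici 0) :=
    (dPhi_cont hα).sub (continuousOn_const.mul ((dPhi_cont hα).comp hlin hmaps))
  have hd : ∀ x, 0 < x → HasDerivAt (fun x => Phi α x - Phi α (l * x))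
      (dPhi α x - l * dPhi α (l * x)) x := by
    intro x hx
    refine (Phi_deriv hα x hx).sub ?_
    have := (Phi_deriv hα (l * x) (mul_pos hl0 hx)).comp x ((hasDerivAt_id x).const_mul l)
    rw [mul_one, mul_comm] at this
    exact this
  have hi : ∀ x, 0 < x → ∫ τ in (0:ℝ)..x, (dPhi α τ - l * dPhi α (l * τ)) * (x - τ) ^ (-α) =
      (Real.Gamma (1 - α) / (1 + α)) * x *
        (l ^ (1 + α) * Phi α (l * x) - Phi α x) := by
    intro x hx
    have hs : uIcc 0 x ⊆ Ici (0:ℝ) := by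
      rw [uIcc_of_le hx.le]; exact fun y hy => hy.1
    simp_rw [sub_mul]
    rw [intervalIntegral.integral_sub, caputo_Phi hα hx, caputo_scale hα hl0 hx]
    · ring
    · exact (ker_int hα).continuousOn_mul ((dPhi_cont hα).mono hs)
    · exact (ker_int hα).continuousOn_mul
        ((continuousOn_const.mul ((dPhi_cont hα).comp hlin hmaps)).mono hs)
  have hz : Phi α 0 - Phi α (l * 0) = 0 := by simp
  constructor
  · have := caputo_comp hα (f := fun x => -(Phi α x - Phi α (l * x)))
      (f' := fun x => -(dPhi α x - l * dPhi α (l * x))) (M := 0) c1.neg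
      (fun x hx => (hd x hx).neg) c2.neg (by simp)
      (by
        intro x hx hM
        simp only [neg_mul, intervalIntegral.integral_neg]
        rw [hi x hx, neg_lt_zero]
        refine mul_pos (mul_pos (Kpos hα) hx) ?_
        have := Phi_nonneg hα (mul_pos hl0 hx).le
        nlinarith) x hx
    linarith
  · have hinv : (l ^ (1 + α))⁻¹ ≤ 1 := inv_le_one_of_one_le₀ hL1
    refine caputo_comp hα (f := fun x => (Phi α x - Phi α (l * x)))
      (f' := fun x => (dPhi α x - l * dPhi α (l * x))) (M := 1 - (l ^ (1 + α))⁻¹) c1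
      hd c2 (by simp [hinv]) ?_ x hx
    intro x hx hM
    rw [hi x hx]
    refine mul_neg_of_pos_of_neg (mul_pos (Kpos hα) hx) ?_
    have hp1 := Phi_le_one hα hx.le
    have hLpos : 0 < l ^ (1 + α) := by linarith
    have hm := mul_lt_mul_of_pos_left hM hLpos
    rw [mul_sub, mul_inv_cancel₀ hLpos.ne'] at hm
    nlinarith

lemma Phi_anti {α : ℝ} (hα : α ∈ Set.Ioo (0:ℝ) 1) {x y : ℝ} (hx : 0 < x) (hxy : x ≤ y) :
    Phi α y ≤ Phi α x := by
  have := (scale_facts hα (l := y / x) (by rwa [one_le_div hx]) hx.le).1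
  rw [div_mul_cancel₀ _ hx.ne'] at this
  linarith

lemma Phi_far {α : ℝ} (hα : α ∈ Set.Ioo (0:ℝ) 1) {x y : ℝ} (hx : 0 < x) (hxy : x ≤ y) :
    Phi α x - Phi α y ≤ 2 * (y - x) / x := by
  have hy : 0 < y := by linarith
  have := (scale_facts hα (l := y / x) (by rwa [one_le_div hx]) hx.le).2
  rw [div_mul_cancel₀ _ hx.ne', ← Real.inv_rpow (by positivity), inv_div] at this
  have hb := one_add_mul_self_le_rpow_one_add (s := x / y - 1)
    (by have : 0 ≤ x / y := by positivity
        linarith) (p := 1 + α) (by linarith [hα.1])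
  rw [add_sub_cancel] at hb
  have hxy1 : x / y ≤ 1 := by rwa [div_le_one hy]
  have h3 : 1 - x / y ≤ (y - x) / x := by
    rw [show 1 - x / y = (y - x) / y by field_simp]
    exact div_le_div_of_nonneg_left (by linarith) hx hxy
  have := hα.2
  rw [mul_div_assoc]
  nlinarith

lemma Phi_near {α : ℝ} (hα : α ∈ Set.Ioo (0:ℝ) 1) {x y : ℝ} (hx : 0 < x) (hxy : x ≤ y)
    (hy : y ≤ 1 / 2) : Phi α x - Phi α y ≤ 4 * (y - x) := by
  have h0 := hα.1
  have hS : HasSum (fun n : ℕ => (n:ℝ) * (1/2) ^ n * (2 * (y - x))) (4 * (y - x)) := by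
    have := (hasSum_coe_mul_geometric_of_norm_lt_one (r := (1/2:ℝ)) (by norm_num)).mul_right
      (2 * (y - x))
    have e : 4 * (y - x) = 1 / 2 / (1 - 1 / 2) ^ 2 * (2 * (y - x)) := by ring
    rw [e]
    exact this
  rw [Phi_eq hx.le, Phi_eq (hx.le.trans hxy),
    ← (summable_term hα hx.le).tsum_sub (summable_term hα (hx.le.trans hxy)), ← hS.tsum_eq]
  refine Summable.tsum_le_tsum (fun n => ?_)
    ((summable_term hα hx.le).sub (summable_term hα (hx.le.trans hxy))) hS.summable
  rcases Nat.eq_zero_or_pos n with rfl | hn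
  · simp
  have hn' : (1:ℝ) ≤ n := by exact_mod_cast hn
  have hp1 : 1 ≤ (1 + α) * n := by nlinarith
  -- derivative bound for the power
  have hpow : y ^ ((1 + α) * n) - x ^ ((1 + α) * n) ≤
      ((1 + α) * n * ((1/2) ^ n * 2)) * (y - x) := by
    have hmv := (convex_Icc x y).norm_image_sub_le_of_norm_hasDerivWithin_le
      (f := fun z : ℝ => z ^ ((1 + α) * n)) (f' := fun z => (1 + α) * n * z ^ ((1 + α) * n - 1))
      (C := (1 + α) * n * ((1/2) ^ n * 2)) (x := x) (y := y)
      (fun z hz => (Real.hasDerivAt_rpow_const (Or.inr hp1)).hasDerivWithinAt)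
      (fun z hz => by
        have hz0 : 0 < z := hx.trans_le hz.1
        rw [Real.norm_of_nonneg (by positivity)]
        gcongr
        calc z ^ ((1 + α) * n - 1) ≤ (1/2) ^ ((1 + α) * n - 1) :=
              Real.rpow_le_rpow hz0.le (hz.2.trans hy) (by linarith)
          _ ≤ (1/2) ^ ((n:ℝ) - 1) :=
              Real.rpow_le_rpow_of_exponent_ge (by norm_num) (by norm_num) (by nlinarith)
          _ = (1/2) ^ n * 2 := by
              rw [Real.rpow_sub (by norm_num), Real.rpow_natCast, Real.rpow_one]
              ring)
      ⟨le_rfl, hxy⟩ ⟨hxy, le_rfl⟩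
    rw [Real.norm_eq_abs, Real.norm_of_nonneg (sub_nonneg.2 hxy)] at hmv
    exact (le_abs_self _).trans hmv
  have hmono : 0 ≤ y ^ ((1 + α) * n) - x ^ ((1 + α) * n) :=
    sub_nonneg.2 (Real.rpow_le_rpow hx.le hxy (by linarith))
  have hcf : |cf α n| * (1 + α) ≤ 1 := by
    rw [abs_cf_eq hα]
    obtain ⟨m, rfl⟩ : ∃ m, n = m + 1 := ⟨n - 1, by omega⟩
    rw [pow_succ]
    have hc : (1 / (1 + α)) ^ m ≤ 1 := pow_le_one₀ (by positivity)
      (by rw [div_le_one (by linarith)]; linarith)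
    have hb1 := bCoef_le_one hα (m + 1)
    have hb0 := bCoef_pos hα (m + 1)
    calc _ = bCoef α (m+1) * (1 / (1 + α)) ^ m := by field_simp
      _ ≤ 1 * 1 := by gcongr
      _ = 1 := by ring
  calc cf α n * x ^ ((1 + α) * n) - cf α n * y ^ ((1 + α) * n)
      = (-cf α n) * (y ^ ((1 + α) * n) - x ^ ((1 + α) * n)) := by ring
    _ ≤ |cf α n| * (y ^ ((1 + α) * n) - x ^ ((1 + α) * n)) := by
        gcongr; exact neg_le_abs _
    _ ≤ |cf α n| * (((1 + α) * n * ((1/2) ^ n * 2)) * (y - x)) := by gcongr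
    _ = (|cf α n| * (1 + α)) * (n * (1/2) ^ n * (2 * (y - x))) := by ring
    _ ≤ 1 * (n * (1/2) ^ n * (2 * (y - x))) := by
        have : 0 ≤ y - x := sub_nonneg.2 hxy
        gcongr
    _ = _ := one_mul _

lemma Phi_all {α : ℝ} (hα : α ∈ Set.Ioo (0:ℝ) 1) {x y : ℝ} (hx : 0 < x) (hxy : x ≤ y) :
    Phi α x - Phi α y ≤ 4 * (y - x) := by
  have far : ∀ u v : ℝ, 1 / 2 ≤ u → u ≤ v → Phi α u - Phi α v ≤ 4 * (v - u) := by
    intro u v hu huv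
    have hu0 : 0 < u := by linarith
    refine (Phi_far hα hu0 huv).trans ?_
    rw [div_le_iff₀ hu0]
    nlinarith
  rcases le_total y (1/2) with h | h
  · exact Phi_near hα hx hxy h
  rcases le_total x (1/2) with h' | h'
  · have a := Phi_near hα hx h' le_rfl
    have b := far (1/2) y le_rfl h
    linarith
  · exact far x y h' hxy

lemma Phi_diff {α : ℝ} (hα : α ∈ Set.Ioo (0:ℝ) 1) {x y : ℝ} (hx : 0 < x) (hxy : x ≤ y) :
    |Phi α y - Phi α x| ≤ 4 * (y - x) * (if x ≤ 1 then 1 else 1 / x) := by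
  rw [abs_sub_comm, abs_of_nonneg (sub_nonneg.2 (Phi_anti hα hx hxy))]
  split_ifs with h
  · simpa using Phi_all hα hx hxy
  · refine (Phi_far hα hx hxy).trans ?_
    rw [mul_one_div]
    gcongr
    · linarith

lemma two_le_C1 {α : ℝ} (hα : α ∈ Set.Ioo (0:ℝ) 1) : 2 ≤ C1 α := by
  have h0 := hα.1
  have h1 := hα.2
  have hk : IntervalIntegrable (fun u : ℝ => (1 - u) ^ (α - 1)) volume (1/2) 1 := by
    have := (intervalIntegral.intervalIntegrable_rpow' (a := 1/2) (b := 0) (r := α - 1)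
      (by linarith)).comp_sub_left 1
    norm_num at this
    exact this
  have hval : ∫ u in (1/2:ℝ)..1, (1 - u) ^ (α - 1) = (1/2) ^ α / α := by
    have := intervalIntegral.integral_comp_sub_left (fun u : ℝ => u ^ (α - 1)) (a := 1/2) (b := 1) 1
    rw [this, integral_rpow (Or.inl (by linarith))]
    norm_num [Real.zero_rpow h0.ne']
  have hle : ∫ u in (1/2:ℝ)..1, (1 - u) ^ (α - 1) ≤
      ∫ u in (1/2:ℝ)..1, u ^ (-(1+α)) * (1-u) ^ (α-1) := by
    refine intervalIntegral.integral_mono_on (by norm_num) hk ?_ ?_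
    · refine hk.continuousOn_mul ?_
      rw [uIcc_of_le (by norm_num)]
      exact continuousOn_id.rpow_const
        (fun u hu => Or.inl (by have : (1/2:ℝ) ≤ u := hu.1
                                simp only [id]; linarith))
    · intro u hu
      have hu0 : (1/2:ℝ) ≤ u := hu.1
      refine le_mul_of_one_le_left (Real.rpow_nonneg (by linarith [hu.2]) _) ?_
      exact Real.one_le_rpow_of_pos_of_le_one_of_nonpos (by linarith) hu.2 (by linarith)
  rw [hval] at hle
  unfold C1
  calc (2:ℝ) = α * 2 ^ (1 + α) * ((1/2) ^ α / α) := by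
        rw [Real.rpow_add (by norm_num), Real.rpow_one, one_div, Real.inv_rpow (by norm_num)]
        have := (Real.rpow_pos_of_pos (show (0:ℝ) < 2 by norm_num) α).ne'
        field_simp
    _ ≤ _ := by
        gcongr
        exact hle.trans (le_max_left _ _)

lemma a0_nonneg {α : ℝ} (hα : α ∈ Set.Ioo (0:ℝ) 1) : 0 ≤ a0 α := by
  unfold a0
  refine inv_nonneg.2 (mul_nonneg (by norm_num) ?_)
  exact setIntegral_nonneg measurableSet_Ioi (fun x hx => Phi_nonneg hα (le_of_lt hx))

lemma fundSol_diff {α : ℝ} (hα : α ∈ Set.Ioo (0:ℝ) 1) {t x y : ℝ} (ht : 1 < t) (hx : 0 < x)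
    (hy : 0 < y) : |fundSol α t (x + y) - fundSol α t x| ≤
      C2 α / t ^ (1/(1+α)) * y * (if x ≤ t ^ (1/(1+α)) then t ^ (-1/(1+α)) else 1/x) := by
  have hT : 0 < t ^ (1/(1+α)) := Real.rpow_pos_of_pos (by linarith) _
  have hinv : t ^ (-1/(1+α)) = (t ^ (1/(1+α)))⁻¹ := by
    rw [← Real.rpow_neg (by linarith), neg_div]
  set T := t ^ (1/(1+α)) with hTdef
  have ha := a0_nonneg hα
  have hC := two_le_C1 hα
  unfold fundSol C2
  rw [hinv, abs_of_pos hx, abs_of_pos (add_pos hx hy), ← mul_sub, abs_mul,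
    abs_of_nonneg (mul_nonneg ha (inv_nonneg.2 hT.le))]
  have hxT : 0 < x * T⁻¹ := by positivity
  have hd := Phi_diff hα (x := x * T⁻¹) (y := (x + y) * T⁻¹) hxT (by gcongr; linarith)
  have hite : (if x * T⁻¹ ≤ 1 then (1:ℝ) else 1 / (x * T⁻¹)) = T * (if x ≤ T then T⁻¹ else 1 / x) := by
    have : x * T⁻¹ ≤ 1 ↔ x ≤ T := by rw [← div_eq_mul_inv, div_le_one hT]
    simp only [this]
    split_ifs
    · field_simp
    · field_simp
  rw [hite] at hd
  have hI : 0 ≤ (if x ≤ T then T⁻¹ else 1 / x) := by split_ifs <;> positivity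
  set I := (if x ≤ T then T⁻¹ else 1 / x)
  calc _ ≤ a0 α * T⁻¹ * (4 * ((x + y) * T⁻¹ - x * T⁻¹) * (T * I)) := by gcongr
    _ = (2 * a0 α * 2) / T * y * I := by field_simp; ring
    _ ≤ _ := by gcongr

lemma fundSol_aesm {α : ℝ} (hα : α ∈ Set.Ioo (0:ℝ) 1) {t x : ℝ} (ht : 1 < t) (hx : 0 < x) :
    ContinuousOn (fun y => fundSol α t (x + y)) (Ioi 0) := by
  have hT : 0 < t ^ (-1/(1+α)) := Real.rpow_pos_of_pos (by linarith) _
  unfold fundSol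
  refine continuousOn_const.mul ((Phi_cont hα).comp (by fun_prop) ?_)
  intro y hy
  exact mul_nonneg (abs_nonneg _) hT.le

lemma fundSol_bdd {α : ℝ} (hα : α ∈ Set.Ioo (0:ℝ) 1) {t x : ℝ} (ht : 1 < t) :
    ‖fundSol α t x‖ ≤ a0 α * t ^ (-1/(1+α)) := by
  have hT : 0 < t ^ (-1/(1+α)) := Real.rpow_pos_of_pos (by linarith) _
  have ha := a0_nonneg hα
  have hz : 0 ≤ |x| * t ^ (-1/(1+α)) := by positivity
  have := Phi_nonneg hα hz
  unfold fundSol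
  rw [Real.norm_of_nonneg (by positivity)]
  exact mul_le_of_le_one_right (by positivity) (Phi_le_one hα hz)

/-- Pointwise bound for `v⁺(x,t) − m·𝔈_t(x)` from Lemma 5 of the paper. -/
theorem stmt9 (α : ℝ) (hα : α ∈ Set.Ioo (0:ℝ) 1) (g : ℝ → ℝ)
    (hg : IntegrableOn g (Set.Ioi 0))
    (hyg : IntegrableOn (fun y => y * g y) (Set.Ioi 0))
    (hsupp : HasCompactSupport g)
    (t : ℝ) (ht : 1 < t) (x : ℝ) (hx : 0 < x) :
    |(∫ y in Set.Ioi (0:ℝ), fundSol α t (x + y) * g y) -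
        (∫ y in Set.Ioi (0:ℝ), g y) * fundSol α t x| ≤
      C2 α / t ^ (1/(1+α)) * (∫ y in Set.Ioi (0:ℝ), |y * g y|) *
        (if x ≤ t ^ (1/(1+α)) then t ^ (-1/(1+α)) else 1/x) := by
  have hint : IntegrableOn (fun y => fundSol α t (x + y) * g y) (Set.Ioi 0) :=
    Integrable.bdd_mul (c := a0 α * t ^ (-1/(1+α))) hg
      ((fundSol_aesm hα ht hx).aestronglyMeasurable measurableSet_Ioi)
      (Eventually.of_forall fun y => fundSol_bdd hα ht)
  rw [← integral_mul_const, ← integral_sub hint (hg.mul_const _), ← Real.norm_eq_abs]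
  set I := (if x ≤ t ^ (1/(1+α)) then t ^ (-1/(1+α)) else 1/x) with hI
  have e : C2 α / t ^ (1/(1+α)) * (∫ y in Set.Ioi (0:ℝ), |y * g y|) * I =
      ∫ y in Set.Ioi (0:ℝ), C2 α / t ^ (1/(1+α)) * I * |y * g y| := by
    rw [integral_const_mul]; ring
  rw [e]
  refine norm_integral_le_of_norm_le (hyg.abs.const_mul _) ?_
  filter_upwards [ae_restrict_mem measurableSet_Ioi] with y hy
  have hy0 : 0 < y := hy
  have h := fundSol_diff hα ht hx hy0
  rw [← hI] at h
  rw [Real.norm_eq_abs, show fundSol α t (x + y) * g y - g y * fundSol α t x =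
    (fundSol α t (x + y) - fundSol α t x) * g y by ring, abs_mul, abs_mul, abs_of_pos hy0]
  calc _ ≤ (C2 α / t ^ (1/(1+α)) * y * I) * |g y| := by gcongr
    _ = _ := by ring
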